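/- Let k ≥ 2 be an integer and let f be smooth (C^∞) on the square K̂ = [−1,1]². Then the Q^k M-type projection f_{k,k} interpolates f at the four corners of K̂: f_{k,k}(σ, τ) = f(σ, τ) for all σ, τ ∈ {−1, 1}. -/

import Mathlib

open intervalIntegral

/-- The Legendre polynomial `l_j(t) = (1/(2^j j!)) (d/dt)^j (t²−1)^j`. -/
noncomputable def legendreP (j : ℕ) (t : ℝ) : ℝ :=
  (1 / (2 ^ j * (Nat.factorial j : ℝ))) * iteratedDeriv j (fun x : ℝ => (x ^ 2 - 1) ^ j) t

/-- The M-type polynomials: `M_0(t) = 1`, `M_1(t) = t`, and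
    `M_{k+1}(t) = (1/(2^k k!)) (d/dt)^{k−1} (t²−1)^k` for `k ≥ 1`. -/
noncomputable def Mpoly : ℕ → ℝ → ℝ
  | 0, _ => 1
  | 1, t => t
  | (k + 2), t =>
      (1 / (2 ^ (k + 1) * (Nat.factorial (k + 1) : ℝ))) *
        iteratedDeriv k (fun x : ℝ => (x ^ 2 - 1) ^ (k + 1)) t

/-- The 2D M-type coefficients `b_{i,j}` of a function `f` on `[−1,1]²`. -/
noncomputable def mcoeff2 (f : ℝ → ℝ → ℝ) : ℕ → ℕ → ℝ
  | 0, 0 => (f (-1) (-1) + f (-1) 1 + f 1 (-1) + f 1 1) / 4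
  | 0, (j + 1) => ((2 * ((j : ℝ) + 1) - 1) / 4) *
      ∫ t in (-1:ℝ)..1, (deriv (f 1) t + deriv (f (-1)) t) * legendreP j t
  | (i + 1), 0 => ((2 * ((i : ℝ) + 1) - 1) / 4) *
      ∫ s in (-1:ℝ)..1,
        (deriv (fun x => f x 1) s + deriv (fun x => f x (-1)) s) * legendreP i s
  | (i + 1), (j + 1) => ((2 * ((i : ℝ) + 1) - 1) * (2 * ((j : ℝ) + 1) - 1) / 4) *
      ∫ s in (-1:ℝ)..1, ∫ t in (-1:ℝ)..1,
        deriv (fun x => deriv (f x) t) s * legendreP i s * legendreP j t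

/-- The `Q^k` M-type projection `f_{k,k}(s,t) = Σ_{i=0}^{k} Σ_{j=0}^{k} b_{i,j} M_i(s) M_j(t)`. -/
noncomputable def mproj2 (f : ℝ → ℝ → ℝ) (k : ℕ) (s t : ℝ) : ℝ :=
  ∑ i ∈ Finset.range (k + 1), ∑ j ∈ Finset.range (k + 1),
    mcoeff2 f i j * Mpoly i s * Mpoly j t

lemma legendreP_zero (t : ℝ) : legendreP 0 t = 1 := by
  simp [legendreP]

lemma iteratedDeriv_polynomial_eval (p : Polynomial ℝ) (n : ℕ) :
    iteratedDeriv n (fun x => p.eval x) = fun x => (Polynomial.derivative^[n] p).eval x := by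
  induction n with
  | zero => simp
  | succ n ih =>
    funext x
    rw [iteratedDeriv_succ, ih, Polynomial.deriv, Function.iterate_succ_apply']

/-- The M-type polynomials of degree at least two vanish at the endpoints `±1`. -/
lemma Mpoly_add_two_eq_zero (k : ℕ) {x : ℝ} (hx : x ^ 2 = 1) : Mpoly (k + 2) x = 0 := by
  have hp : (fun x : ℝ => (x ^ 2 - 1) ^ (k + 1)) =
      fun x => ((Polynomial.X ^ 2 - 1 : Polynomial ℝ) ^ (k + 1)).eval x := by
    funext x
    simp
  obtain ⟨q, hq⟩ := Polynomial.pow_sub_dvd_iterate_derivative_pow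
    (Polynomial.X ^ 2 - 1 : Polynomial ℝ) (k + 1) k
  simp [Mpoly, hp, iteratedDeriv_polynomial_eval, hq, hx]

/-- At the endpoints `±1` only the two lowest M-type polynomials contribute to a sum. -/
lemma sum_range_mul_Mpoly {k : ℕ} (hk : 1 ≤ k) (c : ℕ → ℝ) {x : ℝ} (hx : x ^ 2 = 1) :
    ∑ i ∈ Finset.range (k + 1), c i * Mpoly i x = c 0 + c 1 * x := by
  obtain ⟨m, rfl⟩ := Nat.exists_eq_add_of_le' hk
  rw [Finset.sum_range_succ', Finset.sum_range_succ']
  have h0 : Mpoly 0 x = 1 := rfl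
  have h1 : Mpoly 1 x = x := rfl
  simp [Mpoly_add_two_eq_zero _ hx, h0, h1, add_comm (c 0)]

/-- The partial derivative in the second variable of a smooth function is smooth. -/
lemma contDiff_uncurry_deriv_right {f : ℝ → ℝ → ℝ}
    (hf : ContDiff ℝ (⊤ : ℕ∞) (Function.uncurry f)) :
    ContDiff ℝ (⊤ : ℕ∞) (Function.uncurry fun s t => deriv (f s) t) := by
  have h : (Function.uncurry fun s t => deriv (f s) t) =
      fun p : ℝ × ℝ => fderiv ℝ (Function.uncurry f) p (0, 1) := by
    funext ⟨s, t⟩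
    have hd := (hf.differentiable (by simp) (s, t)).hasFDerivAt
    exact (hd.comp_hasDerivAt t ((hasDerivAt_const t s).prodMk (hasDerivAt_id t))).deriv
  rw [h]
  exact (hf.fderiv_right (m := (⊤ : ℕ∞)) (by simp)).clm_apply contDiff_const

/-- The partial derivative in the first variable of a smooth function is smooth. -/
lemma contDiff_uncurry_deriv_left {f : ℝ → ℝ → ℝ}
    (hf : ContDiff ℝ (⊤ : ℕ∞) (Function.uncurry f)) :
    ContDiff ℝ (⊤ : ℕ∞) (Function.uncurry fun s t => deriv (fun x => f x t) s) :=
  (contDiff_uncurry_deriv_right (f := fun t s => f s t)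
    (hf.comp (contDiff_snd.prodMk contDiff_fst))).comp (contDiff_snd.prodMk contDiff_fst)

lemma integral_deriv_of_contDiff {g : ℝ → ℝ} (hg : ContDiff ℝ (⊤ : ℕ∞) g) (a b : ℝ) :
    ∫ t in a..b, deriv g t = g b - g a :=
  integral_deriv_eq_sub (fun t _ => hg.differentiable (by simp) t)
    ((hg.continuous_deriv (by simp)).intervalIntegrable a b)

lemma integral_deriv_add_of_contDiff {g h : ℝ → ℝ} (hg : ContDiff ℝ (⊤ : ℕ∞) g)
    (hh : ContDiff ℝ (⊤ : ℕ∞) h) (a b : ℝ) :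
    ∫ t in a..b, (deriv g t + deriv h t) = (g b - g a) + (h b - h a) := by
  rw [integral_add ((hg.continuous_deriv (by simp)).intervalIntegrable a b)
    ((hh.continuous_deriv (by simp)).intervalIntegrable a b),
    integral_deriv_of_contDiff hg, integral_deriv_of_contDiff hh]

/-- The integral over a rectangle of a mixed partial derivative. -/
lemma integral_integral_deriv_deriv {f : ℝ → ℝ → ℝ}
    (hf : ContDiff ℝ (⊤ : ℕ∞) (Function.uncurry f)) (a b c d : ℝ) :
    ∫ s in a..b, ∫ t in c..d, deriv (fun x => deriv (f x) t) s =
      (f b d - f b c) - (f a d - f a c) := by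
  have hg := contDiff_uncurry_deriv_right hf
  have hf_right (s : ℝ) : ContDiff ℝ (⊤ : ℕ∞) (f s) :=
    hf.comp (contDiff_const.prodMk contDiff_id)
  have hg_left (t : ℝ) : ContDiff ℝ (⊤ : ℕ∞) fun x => deriv (f x) t :=
    hg.comp (contDiff_id.prodMk contDiff_const)
  rw [MeasureTheory.intervalIntegral_intervalIntegral_swap]
  · simp_rw [fun t => integral_deriv_of_contDiff (hg_left t) a b]
    rw [integral_sub (((hf_right b).continuous_deriv (by simp)).intervalIntegrable c d)
      (((hf_right a).continuous_deriv (by simp)).intervalIntegrable c d),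
      integral_deriv_of_contDiff (hf_right b), integral_deriv_of_contDiff (hf_right a)]
  · exact ((contDiff_uncurry_deriv_left hg).continuous.continuousOn.integrableOn_compact
      (isCompact_uIcc.prod isCompact_uIcc)).mono_set
      (Set.prod_mono Set.uIoc_subset_uIcc Set.uIoc_subset_uIcc)

/-- Let `k ≥ 2` and let `f` be smooth on the square `[−1,1]²`. Then the
`Q^k` M-type projection `f_{k,k}` interpolates `f` at the four corners. -/
theorem mproj2_interpolates_corners (k : ℕ) (hk : 2 ≤ k) (f : ℝ → ℝ → ℝ)
    (hf : ContDiff ℝ (⊤ : ℕ∞) (Function.uncurry f))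
    (σ τ : ℝ) (hσ : σ = -1 ∨ σ = 1) (hτ : τ = -1 ∨ τ = 1) :
    mproj2 f k σ τ = f σ τ := by
  have hσ2 : σ ^ 2 = 1 := by rcases hσ with rfl | rfl <;> norm_num
  have hτ2 : τ ^ 2 = 1 := by rcases hτ with rfl | rfl <;> norm_num
  have hf_right (s : ℝ) : ContDiff ℝ (⊤ : ℕ∞) (f s) :=
    hf.comp (contDiff_const.prodMk contDiff_id)
  have hf_left (t : ℝ) : ContDiff ℝ (⊤ : ℕ∞) fun x => f x t :=
    hf.comp (contDiff_id.prodMk contDiff_const)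
  have h_sum : mproj2 f k σ τ = mcoeff2 f 0 0 + mcoeff2 f 0 1 * τ +
      (mcoeff2 f 1 0 + mcoeff2 f 1 1 * τ) * σ := by
    rw [mproj2, ← sum_range_mul_Mpoly (by omega : 1 ≤ k) _ hτ2,
      ← sum_range_mul_Mpoly (by omega : 1 ≤ k) _ hτ2,
      ← sum_range_mul_Mpoly (by omega : 1 ≤ k)
        (fun i => ∑ j ∈ Finset.range (k + 1), mcoeff2 f i j * Mpoly j τ) hσ2]
    refine Finset.sum_congr rfl fun i _ => ?_
    rw [Finset.sum_mul]
    exact Finset.sum_congr rfl fun j _ => by ring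
  have h01 : mcoeff2 f 0 1 = (f 1 1 - f 1 (-1) + (f (-1) 1 - f (-1) (-1))) / 4 := by
    simp only [mcoeff2, legendreP_zero, mul_one]
    rw [integral_deriv_add_of_contDiff (hf_right 1) (hf_right (-1))]
    norm_num
    ring
  have h10 : mcoeff2 f 1 0 = (f 1 1 - f (-1) 1 + (f 1 (-1) - f (-1) (-1))) / 4 := by
    simp only [mcoeff2, legendreP_zero, mul_one]
    rw [integral_deriv_add_of_contDiff (hf_left 1) (hf_left (-1))]
    norm_num
    ring
  have h11 : mcoeff2 f 1 1 = (f 1 1 - f 1 (-1) - (f (-1) 1 - f (-1) (-1))) / 4 := by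
    simp only [mcoeff2, legendreP_zero, mul_one]
    rw [integral_integral_deriv_deriv hf]
    norm_num
    ring
  rw [h_sum, h01, h10, h11, mcoeff2]
  rcases hσ with rfl | rfl <;> rcases hτ with rfl | rfl <;> ring
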